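/- If M ∈ 𝓜(6,7,C) with |C| = 19, then there do not exist two distinct colours α, β of frequency 2 whose four occurrences lie in four distinct rows and exactly two columns, with α and β sharing both columns (type (1⁴, 2²)). -/

import Mathlib

/-- `M ∈ 𝓜(p,q,C)`: all lines of `M` have pairwise distinct entries and every
pair of distinct colours of `C` is row-based or column-based in `M`. -/
def MemM {p q : ℕ} {C : Type*} (M : Fin p → Fin q → C) : Prop :=
  (∀ i, Function.Injective (M i)) ∧
  (∀ j, Function.Injective fun i => M i j) ∧
  ∀ c₁ c₂ : C, c₁ ≠ c₂ →
    (∃ i j₁ j₂, M i j₁ = c₁ ∧ M i j₂ = c₂) ∨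
    (∃ i₁ i₂ j, M i₁ j = c₁ ∧ M i₂ j = c₂)

/-- The frequency of a colour: its number of occurrences as an entry of `M`. -/
noncomputable def freq {C : Type*} (M : Fin 6 → Fin 7 → C) (γ : C) : ℕ :=
  Nat.card {x : Fin 6 × Fin 7 // M x.1 x.2 = γ}

open Finset in
/-- Normalised version: the four rows are `0,1,2,3` and the two columns are `0,1`. -/
theorem core_1111_22 {C : Type*} [Fintype C] [DecidableEq C] (M : Fin 6 → Fin 7 → C)
    (hM : MemM M) (hC : Fintype.card C = 19) (α β : C) (hab : α ≠ β)
    (ha : ∀ i j, M i j = α → (i = 0 ∧ j = 0) ∨ (i = 2 ∧ j = 1))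
    (hb : ∀ i j, M i j = β → (i = 1 ∧ j = 0) ∨ (i = 3 ∧ j = 1))
    (h00 : M 0 0 = α) (h21 : M 2 1 = α) (h10 : M 1 0 = β) (h31 : M 3 1 = β) : False := by
  obtain ⟨hr, hc, hp⟩ := hM
  let F : Fin 6 × Fin 7 → C := fun x => M x.1 x.2
  let S : C → Finset (Fin 6 × Fin 7) := fun c => univ.filter (fun x => F x = c)
  have memS : ∀ c i j, (i, j) ∈ S c ↔ M i j = c := by intro c i j; simp [S, F]
  -- every colour occurs
  have hocc : ∀ c, ∃ i j, M i j = c := by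
    intro c
    by_cases h : c = α
    · exact ⟨0, 0, by rw [h00, h]⟩
    · rcases hp c α h with ⟨i, j, _, h1, _⟩ | ⟨i, _, j, h1, _⟩ <;> exact ⟨i, j, h1⟩
  -- every colour occurs at least twice
  have h2 : ∀ c, 2 ≤ (S c).card := by
    intro c
    by_contra hlt
    obtain ⟨i, j, hij⟩ := hocc c
    have huniq : ∀ i' j', M i' j' = c → i' = i ∧ j' = j := by
      intro i' j' h'
      have := Finset.card_le_one.1 (by omega : (S c).card ≤ 1) (i', j') ((memS _ _ _).2 h')
        (i, j) ((memS _ _ _).2 hij)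
      simpa using this
    have hsub : (univ : Finset C) ⊆ univ.image (M i) ∪ univ.image (fun k => M k j) := by
      intro d _
      by_cases hd : c = d
      · subst hd; exact mem_union_left _ (mem_image.2 ⟨j, mem_univ _, hij⟩)
      · rcases hp c d hd with ⟨a, b, b', e1, e2⟩ | ⟨a, a', b, e1, e2⟩
        · obtain ⟨rfl, rfl⟩ := huniq _ _ e1
          exact mem_union_left _ (mem_image.2 ⟨b', mem_univ _, e2⟩)
        · obtain ⟨rfl, rfl⟩ := huniq _ _ e1
          exact mem_union_right _ (mem_image.2 ⟨a', mem_univ _, e2⟩)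
    have h1 := card_le_card hsub
    have h3 := card_union_le (univ.image (M i)) (univ.image (fun k => M k j))
    have h4 : (univ.image (M i)).card ≤ 7 := card_image_le.trans (by simp)
    have h5 : (univ.image (fun k => M k j)).card ≤ 6 := card_image_le.trans (by simp)
    rw [card_univ, hC] at h1
    omega
  -- colours of frequency at least three
  let H : Finset C := univ.filter (fun c => 3 ≤ (S c).card)
  have hH : H.card ≤ 4 := by
    have hsum : (univ : Finset (Fin 6 × Fin 7)).card = ∑ c : C, (S c).card :=
      card_eq_sum_card_fiberwise (f := F) (t := univ) (by intro x _; simp)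
    have hle : ∑ c : C, (2 + if 3 ≤ (S c).card then 1 else 0) ≤ ∑ c : C, (S c).card := by
      apply sum_le_sum
      intro c _
      have := h2 c
      split_ifs <;> omega
    rw [← hsum, sum_add_distrib, ← card_filter] at hle
    simp [hC] at hle
    change _ + H.card ≤ _ at hle
    omega
  -- colours missing in columns 0 and 1
  let Q : Finset (Fin 6 × Fin 7) :=
    {(2, 0), (3, 0), (4, 0), (5, 0), (0, 1), (1, 1), (4, 1), (5, 1)}
  let D : Finset C := univ.filter (fun c => ∀ i, M i 0 ≠ c ∧ M i 1 ≠ c)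
  have hD : 9 ≤ D.card := by
    have hsub : (univ : Finset C) ⊆ D ∪ (Q.image F ∪ {α, β}) := by
      intro c _
      by_cases h : c ∈ D
      · exact mem_union_left _ h
      · apply mem_union_right
        simp only [D, mem_filter, mem_univ, true_and, not_forall, not_and_or, not_not] at h
        obtain ⟨i, h⟩ := h
        obtain ⟨j, hj, hij⟩ : ∃ j, (j = 0 ∨ j = 1) ∧ M i j = c := by
          rcases h with h | h
          · exact ⟨0, by simp, h⟩
          · exact ⟨1, by simp, h⟩
        have hcell : ∀ (i : Fin 6) (j : Fin 7), (j = 0 ∨ j = 1) → (i, j) ∈ Q ∨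
            (i = 0 ∧ j = 0) ∨ (i = 2 ∧ j = 1) ∨ (i = 1 ∧ j = 0) ∨ (i = 3 ∧ j = 1) := by decide
        rcases hcell i j hj with hQ | ⟨rfl, rfl⟩ | ⟨rfl, rfl⟩ | ⟨rfl, rfl⟩ | ⟨rfl, rfl⟩
        · exact mem_union_left _ (mem_image.2 ⟨(i, j), hQ, hij⟩)
        · apply mem_union_right; simp [← hij, h00]
        · apply mem_union_right; simp [← hij, h21]
        · apply mem_union_right; simp [← hij, h10]
        · apply mem_union_right; simp [← hij, h31]
    have h1 := card_le_card hsub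
    have h3 := card_union_le D (Q.image F ∪ {α, β})
    have h4 := card_union_le (Q.image F) {α, β}
    have h5 : (Q.image F).card ≤ 8 := card_image_le.trans (by decide)
    have h6 : ({α, β} : Finset C).card ≤ 2 := card_le_two
    rw [card_univ, hC] at h1
    omega
  have hDmem : ∀ c ∈ D, ∀ i, M i 0 ≠ c ∧ M i 1 ≠ c := by
    intro c h; simpa [D] using h
  have hDA : ∀ c ∈ D, ∃ i j, (i = 0 ∨ i = 2) ∧ M i j = c := by
    intro c h
    have hn := hDmem c h
    have hne : α ≠ c := by rw [← h00]; exact (hn 0).1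
    rcases hp α c hne with ⟨i, j, j', e1, e2⟩ | ⟨i, i', j, e1, e2⟩
    · rcases ha _ _ e1 with ⟨rfl, rfl⟩ | ⟨rfl, rfl⟩
      · exact ⟨0, j', by simp, e2⟩
      · exact ⟨2, j', by simp, e2⟩
    · rcases ha _ _ e1 with ⟨rfl, rfl⟩ | ⟨rfl, rfl⟩
      · exact absurd e2 (hn _).1
      · exact absurd e2 (hn _).2
  have hDB : ∀ c ∈ D, ∃ i j, (i = 1 ∨ i = 3) ∧ M i j = c := by
    intro c h
    have hn := hDmem c h
    have hne : β ≠ c := by rw [← h10]; exact (hn 1).1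
    rcases hp β c hne with ⟨i, j, j', e1, e2⟩ | ⟨i, i', j, e1, e2⟩
    · rcases hb _ _ e1 with ⟨rfl, rfl⟩ | ⟨rfl, rfl⟩
      · exact ⟨1, j', by simp, e2⟩
      · exact ⟨3, j', by simp, e2⟩
    · rcases hb _ _ e1 with ⟨rfl, rfl⟩ | ⟨rfl, rfl⟩
      · exact absurd e2 (hn _).1
      · exact absurd e2 (hn _).2
  -- a colour of `D` occurring in the last two rows has frequency at least three
  have hDH : ∀ c ∈ D, ∀ i j, (i = 4 ∨ i = 5) → M i j = c → c ∈ H := by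
    intro c h i j hi hij
    obtain ⟨a, a', ha1, ha2⟩ := hDA c h
    obtain ⟨b, b', hb1, hb2⟩ := hDB c h
    simp only [H, mem_filter, mem_univ, true_and]
    have : 2 < (S c).card := by
      rw [two_lt_card_iff]
      refine ⟨(i, j), (a, a'), (b, b'), (memS _ _ _).2 hij, (memS _ _ _).2 ha2,
        (memS _ _ _).2 hb2, ?_, ?_, ?_⟩ <;>
      · intro e
        have e := (Prod.mk.inj e).1
        subst e
        revert hi ha1 hb1
        omega
    omega
  -- key claim
  have key : ∀ i j, (i = 4 ∨ i = 5) → (j = 0 ∨ j = 1) → ∃ i' j', i' < 4 ∧ M i' j' = M i j := by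
    intro i j hi hj
    by_contra hno
    push Not at hno
    have hrow : ∀ i' j', M i' j' = M i j → i' = 4 ∨ i' = 5 := by
      intro i' j' h
      by_contra hh
      exact hno i' j' (by omega) h
    obtain ⟨k, hk⟩ : ∃ k, ∀ i' j', M i' j' = M i j → j' = j ∨ j' = k := by
      by_cases hex : ∃ i' j', i' ≠ i ∧ M i' j' = M i j
      · obtain ⟨i', j', hne, he⟩ := hex
        refine ⟨j', fun a b hh => ?_⟩
        by_cases hai : a = i
        · subst hai; exact Or.inl (hr a hh)
        · have hr1 := hrow _ _ hh
          have hr2 := hrow _ _ he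
          have : a = i' := by omega
          subst this
          exact Or.inr (hr a (hh.trans he.symm))
      · push Not at hex
        refine ⟨j, fun a b hh => ?_⟩
        have hai : a = i := by
          by_contra hai
          exact hex a b hai hh
        subst hai; exact Or.inl (hr a hh)
    have hsub : D ⊆ H ∪ ({0, 1, 2, 3} : Finset (Fin 6)).image (fun a => M a k) := by
      intro c hcD
      have hn := hDmem c hcD
      have hne : M i j ≠ c := by
        rcases hj with rfl | rfl
        · exact (hn i).1
        · exact (hn i).2
      rcases hp _ c hne with ⟨a, b, b', e1, e2⟩ | ⟨a, a', b, e1, e2⟩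
      · exact mem_union_left _ (hDH c hcD a b' (hrow _ _ e1) e2)
      · rcases hk _ _ e1 with rfl | rfl
        · rcases hj with rfl | rfl
          · exact absurd e2 (hn _).1
          · exact absurd e2 (hn _).2
        · by_cases h45 : a' = 4 ∨ a' = 5
          · exact mem_union_left _ (hDH c hcD _ _ h45 e2)
          · apply mem_union_right
            refine mem_image.2 ⟨a', ?_, e2⟩
            simp only [mem_insert, mem_singleton]
            omega
    have h1 := card_le_card hsub
    have h3 := card_union_le H (({0, 1, 2, 3} : Finset (Fin 6)).image (fun a => M a k))
    have h4 : (({0, 1, 2, 3} : Finset (Fin 6)).image (fun a => M a k)).card ≤ 4 :=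
      card_image_le.trans (by decide)
    omega
  -- final count over the first four rows
  let T : Finset (Fin 6 × Fin 7) := univ.filter (fun x => x.1 < 4)
  have hT : T.card = 28 := by decide
  let G : Finset C := D ∪ {α, β}
  have hG : 11 ≤ G.card := by
    have hdis : Disjoint D {α, β} := by
      rw [disjoint_left]
      intro c hcD hcc
      have hn := hDmem c hcD
      simp only [mem_insert, mem_singleton] at hcc
      rcases hcc with rfl | rfl
      · exact (hn 0).1 h00
      · exact (hn 1).1 h10
    have : G.card = D.card + ({α, β} : Finset C).card := card_union_of_disjoint hdis
    rw [card_pair hab] at this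
    omega
  let U : C → Finset (Fin 6 × Fin 7) := fun c => T.filter (fun x => F x = c)
  have memU : ∀ c i j, (i, j) ∈ U c ↔ i < 4 ∧ M i j = c := by intro c i j; simp [U, T, F]
  have hU1 : ∀ c, 1 ≤ (U c).card := by
    intro c
    apply Finset.card_pos.2
    by_cases h : c ∈ D
    · obtain ⟨a, a', ha1, ha2⟩ := hDA c h
      exact ⟨(a, a'), (memU _ _ _).2 ⟨by omega, ha2⟩⟩
    · simp only [D, mem_filter, mem_univ, true_and, not_forall, not_and_or, not_not] at h
      obtain ⟨i, h⟩ := h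
      obtain ⟨j, hj, hij⟩ : ∃ j, (j = 0 ∨ j = 1) ∧ M i j = c := by
        rcases h with h | h
        · exact ⟨0, by simp, h⟩
        · exact ⟨1, by simp, h⟩
      by_cases hi : i < 4
      · exact ⟨(i, j), (memU _ _ _).2 ⟨hi, hij⟩⟩
      · obtain ⟨i', j', h1, h2⟩ := key i j (by omega) hj
        exact ⟨(i', j'), (memU _ _ _).2 ⟨h1, h2.trans hij⟩⟩
  have hU2 : ∀ c ∈ G, 2 ≤ (U c).card := by
    intro c hcG
    have : 1 < (U c).card := by
      rw [one_lt_card]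
      simp only [G, mem_union, mem_insert, mem_singleton] at hcG
      rcases hcG with h | rfl | rfl
      · obtain ⟨a, a', ha1, ha2⟩ := hDA c h
        obtain ⟨b, b', hb1, hb2⟩ := hDB c h
        refine ⟨(a, a'), (memU _ _ _).2 ⟨by omega, ha2⟩,
          (b, b'), (memU _ _ _).2 ⟨by omega, hb2⟩, ?_⟩
        intro e
        have e := (Prod.mk.inj e).1
        omega
      · exact ⟨(0, 0), (memU _ _ _).2 ⟨by decide, h00⟩, (2, 1),
          (memU _ _ _).2 ⟨by decide, h21⟩, by decide⟩
      · exact ⟨(1, 0), (memU _ _ _).2 ⟨by decide, h10⟩, (3, 1),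
          (memU _ _ _).2 ⟨by decide, h31⟩, by decide⟩
    omega
  have hsum : T.card = ∑ c : C, (U c).card :=
    card_eq_sum_card_fiberwise (f := F) (t := univ) (by intro x _; simp)
  have hle : ∑ c : C, (1 + if c ∈ G then 1 else 0) ≤ ∑ c : C, (U c).card := by
    apply sum_le_sum
    intro c _
    have := hU1 c
    split_ifs with h
    · exact hU2 c h
    · omega
  rw [← hsum, hT, sum_add_distrib, ← card_filter] at hle
  have hGf : (univ.filter (fun c => c ∈ G)) = G := by ext; simp
  rw [hGf] at hle
  simp [hC] at hle
  omega

/-- A colour of frequency two occurs only in two given distinct cells. -/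
theorem only_two {C : Type*} (M : Fin 6 → Fin 7 → C) (γ : C) (h : freq M γ = 2)
    (x y : Fin 6 × Fin 7) (hxy : x ≠ y) (hx : M x.1 x.2 = γ) (hy : M y.1 y.2 = γ)
    (z : Fin 6 × Fin 7) (hz : M z.1 z.2 = γ) : z = x ∨ z = y := by
  classical
  unfold freq at h
  rw [Nat.card_eq_fintype_card, Fintype.card_subtype] at h
  by_contra hne
  push Not at hne
  have : 2 < (Finset.univ.filter (fun x : Fin 6 × Fin 7 => M x.1 x.2 = γ)).card := by
    rw [Finset.two_lt_card_iff]
    exact ⟨z, x, y, by simpa using hz, by simpa using hx, by simpa using hy, hne.1, hne.2, hxy⟩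
  omega

/-- An injection of an initial segment extends to a permutation. -/
theorem extend_perm {k n : ℕ} (hkn : k ≤ n) (f : Fin k → Fin n) (hf : Function.Injective f) :
    ∃ σ : Equiv.Perm (Fin n), ∀ a : Fin k, σ (Fin.castLE hkn a) = f a := by
  classical
  let e : {x : Fin n // x ∈ Set.range (Fin.castLE hkn)} ≃ {x : Fin n // x ∈ Set.range f} :=
    (Equiv.ofInjective _ (Fin.castLE_injective hkn)).symm.trans (Equiv.ofInjective f hf)
  refine ⟨e.extendSubtype, fun a => ?_⟩
  rw [Equiv.extendSubtype_apply_of_mem e _ ⟨a, rfl⟩]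
  have : (Equiv.ofInjective _ (Fin.castLE_injective hkn)).symm
      ⟨Fin.castLE hkn a, ⟨a, rfl⟩⟩ = a := by
    rw [Equiv.symm_apply_eq]; rfl
  simp [e, this]

theorem no_type_1111_22 {C : Type*} [Fintype C] (M : Fin 6 → Fin 7 → C)
    (hM : MemM M) (hC : Fintype.card C = 19) :
    ¬ ∃ (α β : C) (i₁ i₂ i₃ i₄ : Fin 6) (j₁ j₂ : Fin 7),
        α ≠ β ∧ freq M α = 2 ∧ freq M β = 2 ∧
        i₁ ≠ i₂ ∧ i₁ ≠ i₃ ∧ i₁ ≠ i₄ ∧ i₂ ≠ i₃ ∧ i₂ ≠ i₄ ∧ i₃ ≠ i₄ ∧ j₁ ≠ j₂ ∧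
        M i₁ j₁ = α ∧ M i₃ j₂ = α ∧ M i₂ j₁ = β ∧ M i₄ j₂ = β := by
  classical
  rintro ⟨α, β, i₁, i₂, i₃, i₄, j₁, j₂, hab, hfa, hfb, h12, h13, h14, h23, h24, h34, hj,
    e1, e2, e3, e4⟩
  obtain ⟨σ, hσ⟩ := extend_perm (by decide : 4 ≤ 6) ![i₁, i₂, i₃, i₄] (by
    intro a b hab
    fin_cases a <;> fin_cases b <;> simp_all)
  obtain ⟨τ, hτ⟩ := extend_perm (by decide : 2 ≤ 7) ![j₁, j₂] (by
    intro a b hab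
    fin_cases a <;> fin_cases b <;> simp_all)
  have s0 : σ 0 = i₁ := hσ 0
  have s1 : σ 1 = i₂ := hσ 1
  have s2 : σ 2 = i₃ := hσ 2
  have s3 : σ 3 = i₄ := hσ 3
  have t0 : τ 0 = j₁ := hτ 0
  have t1 : τ 1 = j₂ := hτ 1
  obtain ⟨hr, hc, hp⟩ := hM
  refine core_1111_22 (fun i j => M (σ i) (τ j)) ⟨?_, ?_, ?_⟩ hC α β hab ?_ ?_
    (by simp [s0, t0, e1]) (by simp [s2, t1, e2]) (by simp [s1, t0, e3]) (by simp [s3, t1, e4])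
  · intro i; exact (hr (σ i)).comp τ.injective
  · intro j; exact (hc (τ j)).comp σ.injective
  · intro c d hcd
    rcases hp c d hcd with ⟨i, j, j', h1, h2⟩ | ⟨i, i', j, h1, h2⟩
    · exact Or.inl ⟨σ.symm i, τ.symm j, τ.symm j', by simpa using h1, by simpa using h2⟩
    · exact Or.inr ⟨σ.symm i, σ.symm i', τ.symm j, by simpa using h1, by simpa using h2⟩
  · intro i j h
    rcases only_two M α hfa (i₁, j₁) (i₃, j₂) (by simp [hj]) e1 e2 (σ i, τ j) h with h | h
    · obtain ⟨ha, hb⟩ := Prod.mk.inj h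
      exact Or.inl ⟨σ.injective (ha.trans s0.symm), τ.injective (hb.trans t0.symm)⟩
    · obtain ⟨ha, hb⟩ := Prod.mk.inj h
      exact Or.inr ⟨σ.injective (ha.trans s2.symm), τ.injective (hb.trans t1.symm)⟩
  · intro i j h
    rcases only_two M β hfb (i₂, j₁) (i₄, j₂) (by simp [hj]) e3 e4 (σ i, τ j) h with h | h
    · obtain ⟨ha, hb⟩ := Prod.mk.inj h
      exact Or.inl ⟨σ.injective (ha.trans s1.symm), τ.injective (hb.trans t0.symm)⟩
    · obtain ⟨ha, hb⟩ := Prod.mk.inj h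
      exact Or.inr ⟨σ.injective (ha.trans s3.symm), τ.injective (hb.trans t1.symm)⟩
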